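/- arXiv:2011.02524 — 3 statements merged into one kernel-verified Lean document; each statement's English description precedes it below -/
import Mathlib

section
/- Let M_P > 0, a ∈ ℝ, and 0 ≤ Λ ≤ M_P²/4, and set V(φ) = (1/2)·(φ − a)² + Λ. Then the slow-roll parameter satisfies ε(φ) = (M_P²/2)·(V′(φ)/V(φ))² = 2·(a − φ)²·M_P² / ((a − φ)² + 2Λ)² for all φ with V(φ) ≠ 0, and the value φ_end = a + √(M_P² − 2Λ + √(M_P⁴ − 4Λ·M_P²)) satisfies ε(φ_end) = 1. -/
/-- For the modified quadratic potential `V(φ) = (φ−a)²/2 + Λ` with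
`0 ≤ Λ ≤ M_P²/4`, the slow-roll parameter is
`ε(φ) = 2(a−φ)²M_P²/((a−φ)² + 2Λ)²`, and
`φ_end = a + √(M_P² − 2Λ + √(M_P⁴ − 4ΛM_P²))` satisfies `ε(φ_end) = 1`. -/
theorem stmt_11 (M_P a Λ φend : ℝ) (hMP : 0 < M_P) (hΛ0 : 0 ≤ Λ)
    (hΛ : Λ ≤ M_P ^ 2 / 4)
    (V : ℝ → ℝ) (hV : V = fun φ => (1 / 2) * (φ - a) ^ 2 + Λ)
    (hφend : φend = a +
      Real.sqrt (M_P ^ 2 - 2 * Λ + Real.sqrt (M_P ^ 4 - 4 * Λ * M_P ^ 2))) :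
    (∀ φ : ℝ, V φ ≠ 0 →
      (M_P ^ 2 / 2) * (deriv V φ / V φ) ^ 2 =
        2 * (a - φ) ^ 2 * M_P ^ 2 / ((a - φ) ^ 2 + 2 * Λ) ^ 2) ∧
    (M_P ^ 2 / 2) * (deriv V φend / V φend) ^ 2 = 1 := by
  have hderiv (φ : ℝ) : deriv V φ = φ - a := by
    have h : HasDerivAt V ((1 / 2) * (2 * (φ - a))) φ := by
      rw [hV]
      simpa using ((((hasDerivAt_id φ).sub_const a).pow 2).const_mul (1 / 2 : ℝ)).add_const Λ
    rw [h.deriv]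
    ring
  have hVφ (φ : ℝ) : V φ = ((a - φ) ^ 2 + 2 * Λ) / 2 := by
    rw [hV]
    ring
  constructor
  · intro φ hφ
    rw [hVφ] at hφ
    have hne : (a - φ) ^ 2 + 2 * Λ ≠ 0 := fun h => hφ (by rw [h, zero_div])
    rw [hderiv, hVφ]
    field_simp
    ring
  · have hrad : 0 ≤ M_P ^ 4 - 4 * Λ * M_P ^ 2 := by
      nlinarith [mul_nonneg (sq_nonneg M_P) (sub_nonneg.2 hΛ)]
    have hr := Real.sq_sqrt hrad
    have hr0 := Real.sqrt_nonneg (M_P ^ 4 - 4 * Λ * M_P ^ 2)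
    set r := Real.sqrt (M_P ^ 4 - 4 * Λ * M_P ^ 2)
    have hsq : (φend - a) ^ 2 = M_P ^ 2 - 2 * Λ + r := by
      rw [hφend, add_sub_cancel_left, Real.sq_sqrt]
      nlinarith [sq_nonneg M_P]
    have hVend : V φend = (M_P ^ 2 + r) / 2 := by
      rw [hVφ, ← neg_sub φend a, neg_sq, hsq]
      ring
    have hne : M_P ^ 2 + r ≠ 0 := by positivity
    rw [hderiv, hVend, div_pow, hsq]
    field_simp
    linear_combination -hr
end

section
/- Let β ≠ 0, a ∈ ℝ and T ∈ ℝ. Define the effective Gibbs potential G(φ, T) = e^{βφ}·(2(φ − a)·(β(φ − a) + 1)/β + 4T) and the effective pressure P(φ, T) = e^{2βφ}·(2(φ − a)/β + (φ − a)² + 2T). Then for every φ, ∂G/∂φ(φ, T) = e^{−βφ}·∂P/∂φ(φ, T); consequently, wherever ∂P/∂φ ≠ 0, the effective volume V := (∂G/∂P)|_T equals e^{−βφ}. -/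
/-- A function of the form `e^{cx}·q(x)` has derivative `e^{cx}·(c·q(x) + q'(x))`. -/
theorem HasDerivAt.exp_const_mul_mul {q : ℝ → ℝ} {q' x : ℝ} (c : ℝ) (hq : HasDerivAt q q' x) :
    HasDerivAt (fun y => Real.exp (c * y) * q y) (Real.exp (c * x) * (c * q x + q')) x := by
  have hexp : HasDerivAt (fun y => Real.exp (c * y)) (Real.exp (c * x) * (c * 1)) x :=
    ((hasDerivAt_id x).const_mul c).exp
  exact (hexp.mul hq).congr_deriv (by ring)

/-- For the effective Gibbs potential `G(φ,T)` and effective pressure `P(φ,T)` of the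
thermodynamical interpretation, `∂G/∂φ = e^{−βφ}·∂P/∂φ`; hence wherever `∂P/∂φ ≠ 0`
the effective volume `V = (∂G/∂P)|_T` equals `e^{−βφ}`. -/
theorem stmt_13 (β a T : ℝ) (hβ : β ≠ 0)
    (G P : ℝ → ℝ)
    (hG : G = fun φ => Real.exp (β * φ) *
      (2 * (φ - a) * (β * (φ - a) + 1) / β + 4 * T))
    (hP : P = fun φ => Real.exp (2 * β * φ) *
      (2 * (φ - a) / β + (φ - a) ^ 2 + 2 * T)) :
    (∀ φ, deriv G φ = Real.exp (-(β * φ)) * deriv P φ) ∧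
    (∀ φ, deriv P φ ≠ 0 → deriv G φ / deriv P φ = Real.exp (-(β * φ))) := by
  have key : ∀ φ, deriv G φ = Real.exp (-(β * φ)) * deriv P φ := by
    intro φ
    have hx : HasDerivAt (fun y : ℝ => y - a) 1 φ := (hasDerivAt_id φ).sub_const a
    have hGd := HasDerivAt.exp_const_mul_mul β ((((hx.const_mul 2).mul
      ((hx.const_mul β).add_const 1)).div_const β).add_const (4 * T))
    have hPd := HasDerivAt.exp_const_mul_mul (2 * β)
      ((((hx.const_mul 2).div_const β).add (hx.pow 2)).add_const (2 * T))
    have hexp : Real.exp (-(β * φ)) * Real.exp (2 * β * φ) = Real.exp (β * φ) := by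
      rw [← Real.exp_add]
      congr 1
      ring
    rw [hG, hP]
    refine hGd.deriv.trans (Eq.trans ?_ (congrArg _ hPd.deriv.symm))
    rw [← mul_assoc (Real.exp (-(β * φ))), hexp]
    congr 1
    simp only [Pi.mul_apply, Pi.add_apply, Pi.pow_apply]
    field_simp
    ring
  exact ⟨key, fun φ h => by rw [key φ, mul_div_cancel_right₀ _ h]⟩
end

section
/- Let β ≠ 0, a ∈ ℝ and T ∈ ℝ, and define G(φ, T) = e^{βφ}·(2(φ − a)·(β(φ − a) + 1)/β + 4T) and P(φ, T) = e^{2βφ}·(2(φ − a)/β + (φ − a)² + 2T). Then for every φ the Helmholtz free energy G(φ, T) − P(φ, T)·e^{−βφ} equals e^{βφ}·((φ − a)² + 2T); equivalently, in the volume variable V = e^{−βφ} > 0, F(T, V) = (1/V)·((a + (1/β)·log V)² + 2T). Consequently the entropy S(T, V) := −∂F/∂T = −2/V is independent of T (so the heat capacity at constant volume C_V = T·∂S/∂T|_V vanishes identically), and the internal energy U := F + T·S = (1/V)·(a + (1/β)·log V)² is independent of T. -/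
/-- The Helmholtz free energy `F = G − PV` of the effective thermodynamics equals
`e^{βφ}((φ−a)² + 2T)`, i.e. `F(T,V) = (1/V)((a + (1/β)log V)² + 2T)` in the volume
variable `V = e^{−βφ}`; the entropy `S = −∂F/∂T = −2/V` is independent of `T`
(so `C_V = T·∂S/∂T = 0`), and the internal energy
`U = F + TS = (1/V)(a + (1/β)log V)²` is independent of `T`. -/
theorem stmt_14 (β a T : ℝ) (hβ : β ≠ 0)
    (G P : ℝ → ℝ) (F S U : ℝ → ℝ → ℝ)
    (hG : G = fun φ => Real.exp (β * φ) *
      (2 * (φ - a) * (β * (φ - a) + 1) / β + 4 * T))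
    (hP : P = fun φ => Real.exp (2 * β * φ) *
      (2 * (φ - a) / β + (φ - a) ^ 2 + 2 * T))
    (hF : F = fun T' V => (1 / V) * ((a + (1 / β) * Real.log V) ^ 2 + 2 * T'))
    (hS : S = fun T' V => -(deriv (fun T'' => F T'' V) T'))
    (hU : U = fun T' V => F T' V + T' * S T' V) :
    (∀ φ, G φ - P φ * Real.exp (-(β * φ)) =
      Real.exp (β * φ) * ((φ - a) ^ 2 + 2 * T)) ∧
    (∀ φ, G φ - P φ * Real.exp (-(β * φ)) = F T (Real.exp (-(β * φ)))) ∧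
    (∀ T' V : ℝ, 0 < V → S T' V = -2 / V) ∧
    (∀ T' V : ℝ, 0 < V → T' * deriv (fun T'' => S T'' V) T' = 0) ∧
    (∀ T' V : ℝ, 0 < V → U T' V = (1 / V) * (a + (1 / β) * Real.log V) ^ 2) := by
  subst hG hP
  have hE : ∀ φ, Real.exp (β * φ) * (2 * (φ - a) * (β * (φ - a) + 1) / β + 4 * T) -
      Real.exp (2 * β * φ) * (2 * (φ - a) / β + (φ - a) ^ 2 + 2 * T) * Real.exp (-(β * φ)) =
      Real.exp (β * φ) * ((φ - a) ^ 2 + 2 * T) := by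
    intro φ
    have h : Real.exp (2 * β * φ) * Real.exp (-(β * φ)) = Real.exp (β * φ) := by
      rw [← Real.exp_add]
      ring_nf
    rw [mul_right_comm (Real.exp (2 * β * φ)), h]
    field_simp
    ring
  have hS' : ∀ T' V : ℝ, S T' V = -2 / V := by
    intro T' V
    have h : HasDerivAt (fun T'' => F T'' V) (1 / V * (2 * 1)) T' := by
      rw [hF]
      exact (((hasDerivAt_id T').const_mul 2).const_add _).const_mul _
    rw [hS]
    simp only [h.deriv]
    ring
  refine ⟨hE, fun φ => (hE φ).trans ?_, fun T' V _ => hS' T' V, fun T' V _ => ?_,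
    fun T' V _ => ?_⟩
  · simp only [hF, Real.log_exp]
    rw [Real.exp_neg]
    field_simp
    ring
  · simp [hS']
  · rw [hU]
    simp only [hS']
    rw [hF]
    ring
end
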